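/- arXiv:2103.11711 — 5 statements merged into one kernel-verified Lean document; each statement's English description precedes it below -/
import Mathlib

section
/- Let p ∈ ℕ (p ≥ 1) and let γ ∈ (0,1) and b ≥ 0 satisfy 0 ≤ b ≤ 2(1−γ) and p²(2(1−γ)+b)² + 16(1−γ)² − 8pγ(2(1−γ)+b) < 0. If f ∈ 𝒜_{p,b} satisfies f'(z) ≠ 0 for all z ∈ 𝔻 \ {0} and Re √(f'(z)/(p z^{p−1})) > √(((4+(2+b)p)γ − 2(1+p)γ² − 2)/(p(b+2(1−γ)))) for all z ∈ 𝔻, then Re(f(z)/z^p) > γ for all z ∈ 𝔻 \ {0} (equivalently, the analytic extension g of f(z)/z^p satisfies Re g(z) > γ on 𝔻). -/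
open Complex Metric Set Filter Topology

set_option maxHeartbeats 1000000

lemma aux_real (q t r c : ℝ) (ht0 : 0 ≤ t) (ht1 : t < 1) (hr0 : 0 ≤ r) (hr1 : r ≤ 1)
    (hc : c ≤ q)
    (h : q ^ 2 - 2 * r * c + r ^ 2 ≤ t ^ 2 * (1 - 2 * r * c + r ^ 2 * q ^ 2)) :
    q * (1 + r * t) ≤ t + r := by
  by_contra! hlt
  have h1 : 0 ≤ r * (1 - t ^ 2) * (q - c) :=
    mul_nonneg (mul_nonneg hr0 (by nlinarith)) (by linarith)
  have h2 : (q * (1 + r * t) - (t + r)) * (q * (1 - r * t) - (r - t)) ≤ 0 := by nlinarith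
  have h3 : 0 < 1 + r * t := by positivity
  have h4 : 0 < 1 - r * t := by nlinarith
  have h5 : q * (1 - r * t) - (r - t) ≤ 0 := by
    by_contra! h6
    nlinarith [mul_pos (sub_pos.2 hlt) h6]
  have h6 : (t + r) * (1 - r * t) < q * (1 + r * t) * (1 - r * t) :=
    mul_lt_mul_of_pos_right hlt h4
  have h7 : q * (1 - r * t) * (1 + r * t) ≤ (r - t) * (1 + r * t) :=
    mul_le_mul_of_nonneg_right (by linarith) h3.le
  have h8 : 0 ≤ t * (1 - r ^ 2) := mul_nonneg ht0 (by nlinarith)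
  nlinarith

lemma schwarz_refined (F : ℂ → ℂ) (R β : ℝ) (hR : 0 < R) (hβ : 0 ≤ β)
    (hF : DifferentiableOn ℂ F (ball 0 R)) (hF0 : F 0 = 0) (hFb : deriv F 0 = (β : ℂ))
    (hFm : ∀ z ∈ ball (0 : ℂ) R, ‖F z‖ ≤ 1) (z : ℂ) (hz : z ∈ ball (0 : ℂ) R) :
    ‖F z‖ * (1 + R * β * (‖z‖ / R)) ≤ ‖z‖ / R * (‖z‖ / R + R * β) := by
  have hm : MapsTo F (ball 0 R) (closedBall (F 0) 1) := by
    intro w hw; simpa [hF0] using hFm w hw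
  set φ : ℂ → ℂ := fun w => R * dslope F 0 w with hφ
  have hφd : DifferentiableOn ℂ φ (ball 0 R) :=
    ((Complex.differentiableOn_dslope (ball_mem_nhds _ hR)).2 hF).const_mul _
  have hφ1 : ∀ w ∈ ball (0 : ℂ) R, ‖φ w‖ ≤ 1 := by
    intro w hw
    have := norm_dslope_le_div_of_mapsTo_ball hF hm hw
    rw [le_div_iff₀ hR] at this
    simp only [hφ, norm_mul, Complex.norm_real, Real.norm_eq_abs, abs_of_pos hR]
    linarith
  have hφ0 : φ 0 = ((R * β : ℝ) : ℂ) := by simp [hφ, hFb]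
  have hρ0 : 0 ≤ R * β := by positivity
  have hρ1 : R * β ≤ 1 := by
    have := hφ1 0 (by simpa using hR)
    rwa [hφ0, Complex.norm_real, Real.norm_eq_abs, abs_of_nonneg hρ0] at this
  set ρ := R * β with hρ
  have hzR : ‖z‖ < R := by simpa using hz
  have ht0 : 0 ≤ ‖z‖ / R := by positivity
  have ht1 : ‖z‖ / R < 1 := by rwa [div_lt_one hR]
  set t := ‖z‖ / R with htdef
  have hFz : ‖F z‖ = t * ‖φ z‖ := by
    have h1 : z * dslope F 0 z = F z := by
      have := sub_smul_dslope F 0 z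
      simpa [hF0] using this
    rw [← h1]
    simp only [hφ, norm_mul, Complex.norm_real, Real.norm_eq_abs, abs_of_pos hR, htdef]
    field_simp
  have key : ‖φ z‖ * (1 + ρ * t) ≤ t + ρ := by
    rcases hρ1.eq_or_lt with h | h
    · rw [h]; nlinarith [hφ1 z hz]
    have hne : ∀ w ∈ ball (0 : ℂ) R, 1 - (ρ : ℂ) * φ w ≠ 0 := by
      intro w hw h0
      have : ‖(ρ : ℂ) * φ w‖ = 1 := by rw [← sub_eq_zero.1 h0]; simp
      rw [norm_mul, Complex.norm_real, Real.norm_eq_abs, abs_of_nonneg hρ0] at this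
      nlinarith [hφ1 w hw]
    have e1 : ∀ w : ℂ, ‖w - ρ‖ ^ 2 = ‖w‖ ^ 2 - 2 * ρ * w.re + ρ ^ 2 := by
      intro w
      simp only [← Complex.normSq_eq_norm_sq, Complex.normSq_apply]; simp; ring
    have e2 : ∀ w : ℂ, ‖1 - ρ * w‖ ^ 2 = 1 - 2 * ρ * w.re + ρ ^ 2 * ‖w‖ ^ 2 := by
      intro w
      simp only [← Complex.normSq_eq_norm_sq, Complex.normSq_apply]; simp; ring
    set ψ : ℂ → ℂ := fun w => (φ w - ρ) / (1 - ρ * φ w) with hψ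
    have hψd : DifferentiableOn ℂ ψ (ball 0 R) :=
      (hφd.sub_const _).div ((hφd.const_mul _).const_sub _) hne
    have hψ0 : ψ 0 = 0 := by simp [hψ, hφ0]
    have hψm : MapsTo ψ (ball 0 R) (closedBall (ψ 0) 1) := by
      intro w hw
      rw [hψ0, mem_closedBall_zero_iff]
      simp only [hψ, norm_div]
      rw [div_le_one (norm_pos_iff.2 (hne w hw))]
      apply le_of_sq_le_sq _ (norm_nonneg _)
      rw [e1, e2]
      have a1 : ‖φ w‖ ^ 2 ≤ 1 := by nlinarith [hφ1 w hw, norm_nonneg (φ w)]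
      have a2 : ρ ^ 2 ≤ 1 := by nlinarith
      nlinarith
    have hs := dist_le_div_mul_dist_of_mapsTo_ball hψd hψm hz
    rw [hψ0, dist_zero_right, dist_zero_right] at hs
    simp only [hψ, norm_div] at hs
    rw [div_le_iff₀ (norm_pos_iff.2 (hne z hz)), show 1 / R * ‖z‖ = t by rw [htdef]; ring] at hs
    have hs2 := pow_le_pow_left₀ (norm_nonneg _) hs 2
    rw [mul_pow, e1, e2] at hs2
    exact aux_real _ _ _ _ ht0 ht1 hρ0 hρ1 (Complex.re_le_norm _) hs2
  rw [hFz]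
  nlinarith [mul_le_mul_of_nonneg_left key ht0]

lemma deriv_nonpos_of_left (N : ℝ → ℝ) (d : ℝ) (h : HasDerivAt N d 1) (h1 : N 1 = 0)
    (hN : ∀ t : ℝ, 0 < t → t < 1 → 0 ≤ N t) : d ≤ 0 := by
  have h2 := (hasDerivAt_iff_tendsto_slope.1 h).mono_left
    (nhdsWithin_mono (1 : ℝ) (show Iio (1 : ℝ) ⊆ {1}ᶜ from fun x hx => ne_of_lt hx))
  refine le_of_tendsto h2 ?_
  filter_upwards [self_mem_nhdsWithin, mem_nhdsWithin_of_mem_nhds (Ioi_mem_nhds zero_lt_one)]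
    with t ht ht0
  rw [slope_def_field, h1, sub_zero]
  exact div_nonpos_of_nonneg_of_nonpos (hN t ht0 ht) (by simpa using (le_of_lt ht))

/-- boundary estimate -/
lemma boundary (P : ℂ → ℂ) (β : ℝ) (hβ : 0 ≤ β) (z₀ : ℂ) (hz0 : z₀ ≠ 0) (hz1 : ‖z₀‖ < 1)
    (hP : DifferentiableOn ℂ P (ball 0 1)) (hP0 : P 0 = 1) (hPb : deriv P 0 = ((2 * β : ℝ) : ℂ))
    (hpos : ∀ z, ‖z‖ < ‖z₀‖ → 0 < (P z).re) (hre0 : (P z₀).re ≤ 0) :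
    (P z₀).re = 0 ∧ (z₀ * deriv P z₀).im = 0 ∧
      (1 + β) * (z₀ * deriv P z₀).re ≤ - (1 + (P z₀).im ^ 2) := by
  have hR : 0 < ‖z₀‖ := norm_pos_iff.2 hz0
  set R := ‖z₀‖ with hRdef
  have hda : ∀ z, ‖z‖ < 1 → DifferentiableAt ℂ P z := fun z hz =>
    hP.differentiableAt (isOpen_ball.mem_nhds (by simpa using hz))
  -- nonneg on the closed ball
  have hnn : ∀ z, ‖z‖ = R → 0 ≤ (P z).re := by
    intro z hz
    have hc : ContinuousAt (fun t : ℝ => (P (t * z)).re) 1 := by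
      apply Complex.continuous_re.continuousAt.comp
      apply ContinuousAt.comp (g := P)
      · simpa using (hda z (by rw [hz]; exact hz1)).continuousAt
      · fun_prop
    have h2 : Tendsto (fun t : ℝ => (P (t * z)).re) (𝓝[<] 1) (𝓝 (P z).re) := by
      have := hc.tendsto.mono_left (nhdsWithin_le_nhds (s := Iio (1 : ℝ)))
      simpa using this
    refine ge_of_tendsto h2 ?_
    filter_upwards [self_mem_nhdsWithin, mem_nhdsWithin_of_mem_nhds (Ioi_mem_nhds zero_lt_one)]
      with t ht ht0
    apply (hpos _ _).le
    rw [norm_mul, Complex.norm_real, Real.norm_eq_abs, abs_of_pos ht0, hz]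
    have : t < 1 := ht
    nlinarith
  have hre : (P z₀).re = 0 := le_antisymm hre0 (hnn z₀ rfl)
  refine ⟨hre, ?_, ?_⟩
  · have hd : HasDerivAt (fun θ : ℝ => P (z₀ * Complex.exp (θ * I))) (deriv P z₀ * (z₀ * I)) 0 := by
      have h1 : HasDerivAt (fun w : ℂ => z₀ * Complex.exp (w * I)) (z₀ * I) ((0 : ℝ) : ℂ) := by
        have := (((hasDerivAt_id ((0 : ℝ) : ℂ)).mul_const I).cexp).const_mul z₀
        simpa using this
      have h2 : HasDerivAt P (deriv P z₀) (z₀ * Complex.exp (((0 : ℝ) : ℂ) * I)) := by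
        simpa using (hda z₀ hz1).hasDerivAt
      exact (HasDerivAt.comp (h := fun w : ℂ => z₀ * Complex.exp (w * I)) _ h2 h1).comp_ofReal
    have hd2 : HasDerivAt (fun θ : ℝ => (P (z₀ * Complex.exp (θ * I))).re)
        (deriv P z₀ * (z₀ * I)).re 0 :=
      (Complex.reCLM.hasFDerivAt.comp_hasDerivAt (0 : ℝ) hd)
    have hmin : IsLocalMin (fun θ : ℝ => (P (z₀ * Complex.exp (θ * I))).re) 0 := by
      refine Eventually.of_forall fun θ => ?_
      simp only [Complex.ofReal_zero, zero_mul, Complex.exp_zero, mul_one, hre]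
      apply hnn
      rw [norm_mul, Complex.norm_exp_ofReal_mul_I, mul_one]
    have := hmin.hasDerivAt_eq_zero hd2
    simp at this ⊢
    linarith
  · set F : ℂ → ℂ := fun z => (P z - 1) / (P z + 1) with hFdef
    have hne : ∀ z ∈ ball (0 : ℂ) R, P z + 1 ≠ 0 := by
      intro z hz h
      have h1 := hpos z (by simpa using hz)
      have h2 := congrArg Complex.re h
      simp at h2
      linarith
    have hsub : ball (0 : ℂ) R ⊆ ball 0 1 := ball_subset_ball hz1.le
    have hPR := hP.mono hsub
    have hFd : DifferentiableOn ℂ F (ball 0 R) := (hPR.sub_const _).div (hPR.add_const _) hne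
    have hF0 : F 0 = 0 := by simp [hFdef, hP0]
    have hFb : deriv F 0 = (β : ℂ) := by
      have h0 := (hda 0 (by simp)).hasDerivAt
      have := (h0.sub_const 1).div (h0.add_const 1) (by rw [hP0]; norm_num)
      have h3 := this.deriv
      rw [hP0, hPb] at h3
      rw [show F = (fun x => P x - 1) / (fun x => P x + 1) from rfl, h3]
      push_cast; norm_num; ring
    have hFm : ∀ z ∈ ball (0 : ℂ) R, ‖F z‖ ≤ 1 := by
      intro z hz
      simp only [hFdef, norm_div]
      rw [div_le_one (norm_pos_iff.2 (hne z hz))]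
      apply le_of_sq_le_sq _ (norm_nonneg _)
      simp only [← Complex.normSq_eq_norm_sq, Complex.normSq_apply]
      simp
      nlinarith [hpos z (by simpa using hz)]
    have hd : HasDerivAt (fun t : ℝ => P (t * z₀)) (deriv P z₀ * z₀) 1 := by
      have h1 : HasDerivAt (fun w : ℂ => w * z₀) z₀ ((1 : ℝ) : ℂ) := by
        simpa using (hasDerivAt_id ((1 : ℝ) : ℂ)).mul_const z₀
      have h2 : HasDerivAt P (deriv P z₀) (((1 : ℝ) : ℂ) * z₀) := by
        simpa using (hda z₀ hz1).hasDerivAt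
      exact (HasDerivAt.comp (h := fun w : ℂ => w * z₀) _ h2 h1).comp_ofReal
    set ρ := R * β with hρ
    have hρ0 : 0 ≤ ρ := by positivity
    have hρβ : ρ ≤ β := by nlinarith
    have hu : HasDerivAt (fun t : ℝ => (P (t * z₀)).re) (deriv P z₀ * z₀).re 1 :=
      (Complex.reCLM.hasFDerivAt.comp_hasDerivAt (1 : ℝ) hd)
    have hv : HasDerivAt (fun t : ℝ => (P (t * z₀)).im) (deriv P z₀ * z₀).im 1 :=
      (Complex.imCLM.hasFDerivAt.comp_hasDerivAt (1 : ℝ) hd)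
    set u : ℝ → ℝ := fun t => (P (t * z₀)).re with hudef
    set v : ℝ → ℝ := fun t => (P (t * z₀)).im with hvdef
    have hu1 : u 1 = 0 := by simp [hudef, hre]
    have hv1 : v 1 = (P z₀).im := by simp [hvdef]
    have hid := hasDerivAt_id (1 : ℝ)
    have hN := ((((hu.add_const 1).pow 2).add (hv.pow 2)).mul
        ((hid.mul (hid.add_const ρ)).pow 2)).sub
        ((((hu.sub_const 1).pow 2).add (hv.pow 2)).mul (((hid.const_mul ρ).const_add 1).pow 2))
    have hle := deriv_nonpos_of_left _ _ hN (by simp [hu1]) (by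
      intro t ht0 ht1
      have hz : (t : ℂ) * z₀ ∈ ball (0 : ℂ) R := by
        rw [mem_ball_zero_iff, norm_mul, Complex.norm_real, Real.norm_eq_abs, abs_of_pos ht0]
        nlinarith
      have hs := schwarz_refined F R β hR hβ hFd hF0 hFb hFm _ hz
      rw [norm_mul, Complex.norm_real, Real.norm_eq_abs, abs_of_pos ht0, ← hRdef,
        mul_div_assoc, div_self hR.ne', mul_one, ← hρ] at hs
      simp only [hFdef, norm_div] at hs
      have hpp := norm_pos_iff.2 (hne _ hz)
      rw [div_mul_eq_mul_div, div_le_iff₀ hpp] at hs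
      have hs2 := pow_le_pow_left₀ (by positivity) hs 2
      simp only [mul_pow, ← Complex.normSq_eq_norm_sq, Complex.normSq_apply] at hs2
      simp at hs2 ⊢
      simp only [hudef, hvdef]
      nlinarith)
    simp [hu1, hv1] at hle
    rw [mul_comm z₀]
    simp only [Complex.mul_re]
    set D := (deriv P z₀).re * z₀.re - (deriv P z₀).im * z₀.im
    have h5 : (1 + ρ) * ((1 + ρ) * D + (1 + (P z₀).im ^ 2)) ≤ 0 := by nlinarith
    have h6 : (1 + ρ) * D + (1 + (P z₀).im ^ 2) ≤ 0 := by
      by_contra! h; nlinarith [mul_pos (by linarith : 0 < 1 + ρ) h]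
    have h7 : D ≤ 0 := by
      by_contra! h; nlinarith [mul_pos (by linarith : 0 < 1 + ρ) h, sq_nonneg (P z₀).im]
    nlinarith

/-- Theorem 3.7: for `f ∈ 𝒜_{p,b}` with `γ ∈ (0,1)`, `0 ≤ b ≤ 2(1-γ)` and
`p²(2(1-γ)+b)² + 16(1-γ)² - 8pγ(2(1-γ)+b) < 0`, the bound
`Re √(f'(z)/(p z^(p-1))) > √(((4+(2+b)p)γ - 2(1+p)γ² - 2)/(p(b+2(1-γ))))` on the disk
implies `Re(f(z)/z^p) > γ` on the punctured disk. -/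
theorem stmt_10 (p : ℕ) (hp : 1 ≤ p) (γ b : ℝ) (hγ0 : 0 < γ) (hγ1 : γ < 1)
    (hb0 : 0 ≤ b) (hb1 : b ≤ 2 * (1 - γ))
    (hcond : (p : ℝ) ^ 2 * (2 * (1 - γ) + b) ^ 2 + 16 * (1 - γ) ^ 2
      - 8 * (p : ℝ) * γ * (2 * (1 - γ) + b) < 0)
    (f g : ℂ → ℂ) (hg : DifferentiableOn ℂ g (Metric.ball 0 1)) (hg0 : g 0 = 1)
    (hgb : deriv g 0 = (b : ℂ))
    (hfg : ∀ z ∈ Metric.ball (0 : ℂ) 1, f z = z ^ p * g z)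
    (hf' : ∀ z ∈ Metric.ball (0 : ℂ) 1, z ≠ 0 → deriv f z ≠ 0)
    (s : ℂ → ℂ) (hs : DifferentiableOn ℂ s (Metric.ball 0 1)) (hs0 : s 0 = 1)
    (hs2 : ∀ z ∈ Metric.ball (0 : ℂ) 1, z ≠ 0 →
      (s z) ^ 2 = deriv f z / ((p : ℂ) * z ^ (p - 1)))
    (hre : ∀ z ∈ Metric.ball (0 : ℂ) 1,
      Real.sqrt (((4 + (2 + b) * (p : ℝ)) * γ - 2 * (1 + (p : ℝ)) * γ ^ 2 - 2) /
        ((p : ℝ) * (b + 2 * (1 - γ)))) < (s z).re) :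
    ∀ z ∈ Metric.ball (0 : ℂ) 1, z ≠ 0 → γ < (f z / z ^ p).re := by
  have hp0 : (0 : ℝ) < p := by exact_mod_cast hp
  have hpC : (p : ℂ) ≠ 0 := by exact_mod_cast hp0.ne'
  have hγ : 0 < 1 - γ := by linarith
  have hγC : (1 - γ : ℂ) ≠ 0 := by exact_mod_cast hγ.ne'
  set k := 2 * (1 - γ) + b with hk
  have hk0 : 0 < k := by linarith
  have hfz : ∀ z ∈ Metric.ball (0 : ℂ) 1, z ≠ 0 → f z / z ^ p = g z := by
    intro z hz hz0
    rw [hfg z hz, mul_div_cancel_left₀ _ (pow_ne_zero _ hz0)]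
  have hgd : ∀ z, ‖z‖ < 1 → DifferentiableAt ℂ g z := fun z hz =>
    hg.differentiableAt (isOpen_ball.mem_nhds (by simpa using hz))
  -- formula for s²
  have hsq : ∀ z ∈ Metric.ball (0 : ℂ) 1, z ≠ 0 → (s z) ^ 2 = g z + z * deriv g z / p := by
    intro z hz hz0
    have h1 : deriv f z = p * z ^ (p - 1) * g z + z ^ p * deriv g z := by
      have he : f =ᶠ[𝓝 z] fun w => w ^ p * g w := by
        filter_upwards [isOpen_ball.mem_nhds hz] with w hw using hfg w hw
      rw [he.deriv_eq]
      exact ((hasDerivAt_pow p z).mul (hgd z (by simpa using hz)).hasDerivAt).deriv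
    have h2 : z ^ p = z ^ (p - 1) * z := by rw [← pow_succ]; congr 1; omega
    have h3 : z ^ (p - 1) ≠ 0 := pow_ne_zero _ hz0
    rw [hs2 z hz hz0, h1, h2]
    field_simp
  intro z hz hz0
  rw [hfz z hz hz0]
  by_contra! hcon
  -- first touching point
  have hz1 : ‖z‖ < 1 := by simpa using hz
  obtain ⟨z₀, hz₀K, hmin⟩ : ∃ z₀ ∈ {w ∈ closedBall (0 : ℂ) ‖z‖ | (g w).re ∈ Iic γ},
      IsMinOn (fun w => ‖w‖) {w ∈ closedBall (0 : ℂ) ‖z‖ | (g w).re ∈ Iic γ} z₀ := by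
    have hcl : ContinuousOn (fun w => (g w).re) (closedBall (0 : ℂ) ‖z‖) :=
      Complex.continuous_re.comp_continuousOn
        (hg.continuousOn.mono (closedBall_subset_ball hz1))
    have hc := hcl.preimage_isClosed_of_isClosed isClosed_closedBall (isClosed_Iic (a := γ))
    have hcomp : IsCompact (closedBall (0 : ℂ) ‖z‖ ∩ (fun w => (g w).re) ⁻¹' Iic γ) :=
      (isCompact_closedBall (0 : ℂ) ‖z‖).of_isClosed_subset hc inter_subset_left
    exact hcomp.exists_isMinOn ⟨z, by simp, hcon⟩ continuous_norm.continuousOn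
  obtain ⟨hz₀b, hz₀γ⟩ := hz₀K
  have hz₀le : ‖z₀‖ ≤ ‖z‖ := by simpa using hz₀b
  have hz₀1 : ‖z₀‖ < 1 := hz₀le.trans_lt hz1
  have hz₀γ' : (g z₀).re ≤ γ := hz₀γ
  have hz₀0 : z₀ ≠ 0 := by
    rintro rfl
    rw [hg0] at hz₀γ'
    simp at hz₀γ'; linarith
  set P : ℂ → ℂ := fun w => (g w - γ) / ((1 - γ : ℝ) : ℂ) with hP
  have hPre : ∀ w, (P w).re = ((g w).re - γ) / (1 - γ) := by
    intro w; simp only [hP]; rw [Complex.div_ofReal_re]; simp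
  have hPim : ∀ w, (P w).im = (g w).im / (1 - γ) := by
    intro w; simp only [hP]; rw [Complex.div_ofReal_im]; simp
  have hPd : ∀ w, ‖w‖ < 1 → deriv P w = deriv g w / ((1 - γ : ℝ) : ℂ) := by
    intro w hw
    exact (((hgd w hw).hasDerivAt.sub_const _).div_const _).deriv
  obtain ⟨hr, him, hbd⟩ := boundary P (b / (2 * (1 - γ))) (by positivity) z₀ hz₀0 hz₀1
    ((hg.sub_const _).div_const _) (by simp only [hP, hg0]; push_cast; exact div_self hγC)
    (by rw [hPd 0 (by simp), hgb]; push_cast; field_simp)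
    (by
      intro w hw
      rw [hPre]
      apply div_pos _ hγ
      by_contra! hneg
      have h1 := hmin (show w ∈ {w ∈ closedBall (0 : ℂ) ‖z‖ | (g w).re ∈ Iic γ} from
        ⟨by simpa using (hw.le.trans hz₀le), by simpa using hneg⟩)
      have h2 : ‖z₀‖ ≤ ‖w‖ := h1
      linarith)
    (by rw [hPre]; exact div_nonpos_of_nonpos_of_nonneg (by linarith) hγ.le)
  rw [hPre] at hr
  rw [hPim] at hbd
  rw [hPd z₀ hz₀1, ← mul_div_assoc, Complex.div_ofReal_im] at him
  rw [hPd z₀ hz₀1, ← mul_div_assoc, Complex.div_ofReal_re] at hbd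
  have hgr : (g z₀).re = γ := by
    rcases div_eq_zero_iff.1 hr with h | h <;> linarith
  have hdi : (z₀ * deriv g z₀).im = 0 := by
    rcases div_eq_zero_iff.1 him with h | h <;> linarith
  have hzb : z₀ ∈ ball (0 : ℂ) 1 := by simpa using hz₀1
  have hS := hsq z₀ hzb hz₀0
  have hRe := hre z₀ hzb
  generalize z₀ * deriv g z₀ = d at *
  set x := (g z₀).im / (1 - γ) with hx
  have hgi : (g z₀).im = (1 - γ) * x := by rw [hx]; field_simp
  have hSre := congrArg Complex.re hS
  have hSim := congrArg Complex.im hS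
  rw [show (p : ℂ) = ((p : ℝ) : ℂ) by simp] at hSre hSim
  rw [pow_two, Complex.mul_re, Complex.add_re, Complex.div_ofReal_re, hgr] at hSre
  rw [pow_two, Complex.mul_im, Complex.add_im, Complex.div_ofReal_im, hdi, hgi] at hSim
  set A := (s z₀).re
  set B := (s z₀).im
  set c := 2 * (1 - γ) ^ 2 / (p * k) with hc
  have hpk : 0 < p * k := by positivity
  have hcpk : c * (p * k) = 2 * (1 - γ) ^ 2 := by rw [hc]; field_simp
  have hδ : ((4 + (2 + b) * (p : ℝ)) * γ - 2 * (1 + (p : ℝ)) * γ ^ 2 - 2) /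
        ((p : ℝ) * (b + 2 * (1 - γ))) = γ - c := by
    rw [show b + 2 * (1 - γ) = k by rw [hk]; ring, hc, div_eq_iff hpk.ne', sub_mul,
      div_mul_cancel₀ _ hpk.ne', hk]
    ring
  rw [hδ] at hRe
  have hc0 : 0 < c := by positivity
  -- 4 c (γ - c) > (1-γ)²
  have hcc : (1 - γ) ^ 2 < 4 * c * (γ - c) := by
    have h1 : (1 - γ) ^ 2 * (p * k) ^ 2 < 4 * c * (γ - c) * (p * k) ^ 2 := by
      have : 4 * c * (γ - c) * (p * k) ^ 2
          = 4 * (c * (p * k)) * (γ * (p * k) - c * (p * k)) := by ring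
      rw [this, hcpk]
      nlinarith [mul_neg_of_pos_of_neg (pow_pos hγ 2) hcond]
    exact lt_of_mul_lt_mul_right h1 (by positivity)
  have hδ0 : 0 < γ - c := by
    by_contra! h
    nlinarith [mul_nonneg hc0.le (sub_nonneg.2 h), pow_pos hγ 2]
  have hA0 : 0 < A := (Real.sqrt_nonneg _).trans_lt hRe
  have hA2 : γ - c < A ^ 2 := (Real.sqrt_lt' hA0).1 hRe
  -- Re d
  have hdre : d.re / p ≤ - c * (1 + x ^ 2) := by
    rw [div_le_iff₀ hp0]
    have e1 : (1 + b / (2 * (1 - γ))) * (d.re / (1 - γ)) = k * d.re / (2 * (1 - γ) ^ 2) := by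
      rw [hk]; field_simp
    rw [e1, div_le_iff₀ (by positivity), ← hcpk] at hbd
    have : k * d.re ≤ k * (-c * (1 + x ^ 2) * p) := hbd.trans_eq (by ring)
    exact le_of_mul_le_mul_left this hk0
  have hAB : 2 * A * B = (1 - γ) * x := by linarith [hSim, zero_div (p : ℝ)]
  have h1 : A ^ 2 - B ^ 2 ≤ γ - c - c * x ^ 2 := by linarith [pow_two A, pow_two B]
  have h2 : c * x ^ 2 < B ^ 2 := by linarith
  have h3 : 4 * A ^ 2 * B ^ 2 = (1 - γ) ^ 2 * x ^ 2 := by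
    rw [← mul_pow, ← hAB]; ring
  have h4 : 4 * (γ - c) * B ^ 2 ≤ (1 - γ) ^ 2 * x ^ 2 := by
    rw [← h3]; nlinarith [sq_nonneg B]
  have h5 : (1 - γ) ^ 2 * x ^ 2 ≤ 4 * c * (γ - c) * x ^ 2 :=
    mul_le_mul_of_nonneg_right hcc.le (sq_nonneg x)
  have h6 := mul_lt_mul_of_pos_left h2 hδ0
  linarith
end

section
/- Let p ∈ ℕ (p ≥ 1) and 0 ≤ b ≤ 1. If f ∈ 𝒜_{p,b} satisfies f'(z) ≠ 0 for all z ∈ 𝔻 \ {0} and Re √(f'(z)/(p z^{p−1})) > √((1+b)p/8) for all z ∈ 𝔻, then Re(f(z)/z^p) > 1/2 for all z ∈ 𝔻 \ {0} (equivalently, the analytic extension g of f(z)/z^p satisfies Re g(z) > 1/2 on 𝔻). -/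
open Metric Set Filter Topology in
theorem growth_aux (W : ℂ → ℂ) (c : ℝ) (hc0 : 0 ≤ c) (hc1 : c < 1)
    (hd : DifferentiableOn ℂ W (ball 0 1)) (hW : ∀ z ∈ ball (0:ℂ) 1, ‖W z‖ ≤ 1)
    (hW0 : W 0 = 0) (hW1 : deriv W 0 = (c:ℂ)) (z : ℂ) (hz : z ∈ ball (0:ℂ) 1) :
    ‖W z‖ * (1 + c * ‖z‖) ≤ ‖z‖ * (‖z‖ + c) := by
  have hmaps : MapsTo W (ball 0 1) (closedBall (W 0) 1) := by
    intro z hz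
    simpa [hW0] using hW z hz
  have hφ : ∀ z ∈ ball (0:ℂ) 1, ‖dslope W 0 z‖ ≤ 1 := fun z hz => by
    simpa using Complex.norm_dslope_le_div_of_mapsTo_ball hd hmaps hz
  have hφd : DifferentiableOn ℂ (dslope W 0) (ball 0 1) :=
    (Complex.differentiableOn_dslope (ball_mem_nhds _ one_pos)).mpr hd
  have hden : ∀ u : ℂ, ‖u‖ ≤ 1 → 1 - (c:ℂ) * u ≠ 0 := by
    intro u hu h
    have h1 : (c:ℂ) * u = 1 := (sub_eq_zero.mp h).symm
    have h2 : ‖(c:ℂ) * u‖ = 1 := by rw [h1]; simp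
    rw [norm_mul, Complex.norm_real, Real.norm_of_nonneg hc0] at h2
    nlinarith [norm_nonneg u]
  have key : ∀ u : ℂ, ‖u‖ ^ 2 = u.re ^ 2 + u.im ^ 2 := fun u => by
    rw [Complex.sq_norm, Complex.normSq_apply]; ring
  set ψ : ℂ → ℂ := fun z => (dslope W 0 z - c) / (1 - c * dslope W 0 z) with hψ
  have hψd : DifferentiableOn ℂ ψ (ball 0 1) := by
    refine (hφd.sub_const _).div ((hφd.const_mul _).const_sub _) ?_
    exact fun z hz => hden _ (hφ z hz)
  have hψ1 : MapsTo ψ (ball 0 1) (closedBall 0 1) := by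
    intro z hz
    have h1 := hφ z hz
    have h2 := norm_pos_iff.mpr (hden _ h1)
    simp only [hψ, mem_closedBall_zero_iff, norm_div]
    rw [div_le_one h2]
    refine le_of_sq_le_sq ?_ h2.le |>.trans le_rfl
    have h3 := key (dslope W 0 z)
    rw [key, key]
    simp
    have : (dslope W 0 z).re ^ 2 + (dslope W 0 z).im ^ 2 ≤ 1 := by
      rw [← h3]; nlinarith [norm_nonneg (dslope W 0 z)]
    nlinarith [mul_nonneg (sub_nonneg.mpr this) (show 0 ≤ 1 - c^2 by nlinarith)]
  have hψ0 : ψ 0 = 0 := by simp [hψ, hW1]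
  have hS := Complex.norm_le_norm_of_mapsTo_ball hψd hψ1 hψ0 (mem_ball_zero_iff.mp hz)
  have h1 := hφ z hz
  have hWz : ‖W z‖ = ‖z‖ * ‖dslope W 0 z‖ := by
    have := sub_smul_dslope W 0 z
    rw [hW0, sub_zero, sub_zero, smul_eq_mul] at this
    rw [← this, norm_mul]
  have hz1 := mem_ball_zero_iff.mp hz
  have hz0 := norm_nonneg z
  rw [hWz, mul_assoc]
  refine mul_le_mul_of_nonneg_left ?_ hz0
  have h2 := norm_pos_iff.mpr (hden _ h1)
  simp only [hψ, norm_div] at hS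
  rw [div_le_iff₀ h2] at hS
  have hS2 := pow_le_pow_left₀ (norm_nonneg _) hS 2
  rw [mul_pow, key (_ - _), key (1 - _)] at hS2
  simp at hS2
  have h3 := key (dslope W 0 z)
  have h4 := Complex.re_le_norm (dslope W 0 z)
  have h5 := norm_nonneg (dslope W 0 z)
  set R := ‖dslope W 0 z‖
  set t := ‖z‖
  set x := (dslope W 0 z).re
  set y := (dslope W 0 z).im
  by_contra hcon
  push Not at hcon
  have hct : 0 ≤ c * t := mul_nonneg hc0 hz0
  have hct1 : c * t < 1 := by nlinarith
  have ht2 : 0 ≤ 1 - t^2 := by nlinarith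
  have hq : ((1 + c*t) * R - (t + c)) * ((1 - c*t) * R - (c - t)) ≤ 0 := by
    have hS3 : R^2 - 2*c*x + c^2 ≤ t^2 * (1 - 2*c*x + c^2 * R^2) := by
      rw [h3]
      linarith
    linarith [mul_nonneg (mul_nonneg hc0 ht2) (sub_nonneg.mpr h4)]
  have hp1 : 0 < (1 + c*t) * R - (t + c) := by linarith
  have hp2 : 0 < (1 - c*t) * R - (c - t) := by
    have : 0 < (1 + c*t) * ((1 - c*t) * R - (c - t)) := by
      nlinarith [mul_pos (show 0 < 1 - c*t by linarith) hp1, mul_nonneg hz0 (show 0 ≤ 1 - c^2 by nlinarith)]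
    exact pos_of_mul_pos_right this (by linarith)
  nlinarith [mul_pos hp1 hp2]

open Metric Set Filter Topology in
theorem half_aux (H : ℂ → ℂ) (c : ℝ) (hc0 : 0 ≤ c) (hc1 : c < 1)
    (hd : DifferentiableOn ℂ H (ball 0 1)) (hH : ∀ z ∈ ball (0:ℂ) 1, 1 / 2 < (H z).re)
    (hH0 : H 0 = 1) (hH1 : deriv H 0 = (c:ℂ)) (z : ℂ) (hz : z ∈ ball (0:ℂ) 1) :
    (1 - 2 * (H z).re) * (1 + c * ‖z‖) ^ 2 +
      ((1 + c * ‖z‖) ^ 2 - ‖z‖ ^ 2 * (‖z‖ + c) ^ 2) * ((H z).re ^ 2 + (H z).im ^ 2) ≤ 0 := by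
  have key : ∀ u : ℂ, ‖u‖ ^ 2 = u.re ^ 2 + u.im ^ 2 := fun u => by
    rw [Complex.sq_norm, Complex.normSq_apply]; ring
  have hne : ∀ z ∈ ball (0:ℂ) 1, H z ≠ 0 := by
    intro z hz h
    have := hH z hz
    rw [h] at this
    norm_num at this
  have hd0 : HasDerivAt H (c:ℂ) 0 := by
    rw [← hH1]
    exact (hd.differentiableAt (ball_mem_nhds _ one_pos)).hasDerivAt
  have hg := growth_aux (fun z => (H z - 1) / H z) c hc0 hc1
    ((hd.sub_const _).div hd hne) ?_ (by simp [hH0]) ?_ z hz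
  · have h2 := norm_pos_iff.mpr (hne z hz)
    simp only [norm_div] at hg
    rw [div_mul_eq_mul_div, div_le_iff₀ h2] at hg
    have hS2 := pow_le_pow_left₀ (by positivity) hg 2
    rw [mul_pow, mul_pow, mul_pow, key (_ - _), key (H z)] at hS2
    simp at hS2
    nlinarith
  · intro z hz
    have h2 := norm_pos_iff.mpr (hne z hz)
    rw [norm_div, div_le_one h2]
    refine le_of_sq_le_sq ?_ h2.le
    rw [key, key]
    simp
    nlinarith [hH z hz]
  · have := (hd0.sub_const 1).div hd0 (by rw [hH0]; simp)
    rw [hH0] at this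
    have h3 := this.deriv
    simp at h3
    exact h3

open Metric Set Filter Topology in
theorem left_deriv_aux (F : ℝ → ℝ) (F' : ℝ) (hF : HasDerivAt F F' 1)
    (h : ∀ t ∈ Ioo (0:ℝ) 1, F t ≤ F 1) : 0 ≤ F' := by
  have h1 := (hasDerivWithinAt_iff_tendsto_slope' (s := Iio (1:ℝ)) (by simp)).mp hF.hasDerivWithinAt
  refine ge_of_tendsto h1 ?_
  filter_upwards [Ioo_mem_nhdsLT (zero_lt_one' ℝ)] with t ht
  rw [slope_def_field]
  exact div_nonneg_of_nonpos (by linarith [h t ht]) (by linarith [ht.2])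

theorem final_aux (x y X q b p : ℝ) (hp : 1 ≤ p) (hb0 : 0 ≤ b)
    (hx : (1 + b) * p / 8 < x ^ 2) (hX : X * (1 + b) ≤ -2 * (1 / 4 + q ^ 2))
    (h1 : (x ^ 2 - y ^ 2) * p = p / 2 + X) (h2 : 2 * x * y = q) : False := by
  subst h2
  have hD : 0 < (1 + b) * p := by positivity
  obtain ⟨D, rfl⟩ : ∃ D, D = (1 + b) * p := ⟨_, rfl⟩
  have h3 : (x^2 - y^2) * ((1+b)*p) ≤ ((1+b)*p)/2 - 2 * (1/4 + (2*x*y)^2) := by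
    nlinarith
  generalize (1 + b) * p = D at *
  have h4 : 0 ≤ y^2 * (8 * x^2 - D) := mul_nonneg (sq_nonneg _) (by linarith)
  have h5 : x^2 * D ≤ D/2 - 1/2 := by nlinarith
  nlinarith [sq_nonneg (D - 2), mul_pos hD (sub_pos.mpr hx)]


/-- Theorem 3.8: for `f ∈ 𝒜_{p,b}` with `0 ≤ b ≤ 1`,
`Re √(f'(z)/(p z^(p-1))) > √((1+b)p/8)` on the disk implies `Re(f(z)/z^p) > 1/2`
on the punctured disk. -/
theorem stmt_11 (p : ℕ) (hp : 1 ≤ p) (b : ℝ) (hb0 : 0 ≤ b) (hb1 : b ≤ 1)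
    (f g : ℂ → ℂ) (hg : DifferentiableOn ℂ g (Metric.ball 0 1)) (hg0 : g 0 = 1)
    (hgb : deriv g 0 = (b : ℂ))
    (hfg : ∀ z ∈ Metric.ball (0 : ℂ) 1, f z = z ^ p * g z)
    (hf' : ∀ z ∈ Metric.ball (0 : ℂ) 1, z ≠ 0 → deriv f z ≠ 0)
    (s : ℂ → ℂ) (hs : DifferentiableOn ℂ s (Metric.ball 0 1)) (hs0 : s 0 = 1)
    (hs2 : ∀ z ∈ Metric.ball (0 : ℂ) 1, z ≠ 0 →
      (s z) ^ 2 = deriv f z / ((p : ℂ) * z ^ (p - 1)))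
    (hre : ∀ z ∈ Metric.ball (0 : ℂ) 1,
      Real.sqrt ((1 + b) * (p : ℝ) / 8) < (s z).re) :
    ∀ z ∈ Metric.ball (0 : ℂ) 1, z ≠ 0 → 1 / 2 < (f z / z ^ p).re := by
  by_contra hcon
  push Not at hcon
  obtain ⟨z1, hz1, hz1ne, hz1re⟩ := hcon
  have hgz1 : (g z1).re ≤ 1 / 2 := by
    rwa [hfg z1 hz1, mul_div_cancel_left₀ _ (pow_ne_zero _ hz1ne)] at hz1re
  have hr1 : ‖z1‖ < 1 := by simpa using hz1
  have hsub : Metric.closedBall (0:ℂ) ‖z1‖ ⊆ Metric.ball 0 1 := Metric.closedBall_subset_ball hr1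
  have hcont : ContinuousOn (fun z => (g z).re) (Metric.closedBall (0:ℂ) ‖z1‖) :=
    Complex.continuous_re.comp_continuousOn (hg.continuousOn.mono hsub)
  have hK : IsCompact (Metric.closedBall (0:ℂ) ‖z1‖ ∩ (fun z => (g z).re) ⁻¹' Set.Iic (1/2)) :=
    (isCompact_closedBall (0:ℂ) ‖z1‖).of_isClosed_subset
      (hcont.preimage_isClosed_of_isClosed Metric.isClosed_closedBall isClosed_Iic)
      Set.inter_subset_left
  obtain ⟨z0, ⟨hz0K, hz0h⟩, hmin⟩ := hK.exists_isMinOn ⟨z1, by simp, hgz1⟩ continuous_norm.continuousOn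
  have hz0h' : (g z0).re ≤ 1/2 := hz0h
  have hz0b := hsub hz0K
  have hz0le : ‖z0‖ ≤ ‖z1‖ := by simpa using hz0K
  have hr1 : ‖z0‖ < 1 := by simpa using hz0b
  have hz0ne : z0 ≠ 0 := by
    rintro rfl
    rw [hg0] at hz0h'
    norm_num at hz0h'
  have hr0 : 0 < ‖z0‖ := norm_pos_iff.mpr hz0ne
  have hin : ∀ z : ℂ, ‖z‖ < ‖z0‖ → 1 / 2 < (g z).re := by
    intro z hz
    by_contra h
    push Not at h
    have : ‖z0‖ ≤ ‖z‖ := hmin ⟨by simpa using hz.le.trans hz0le, h⟩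
    linarith
  have hbd : ∀ z : ℂ, ‖z‖ = ‖z0‖ → 1 / 2 ≤ (g z).re := by
    intro z hz
    have hc : ContinuousAt (fun t : ℝ => (g ((t:ℂ) * z)).re) 1 := by
      have h1 : ContinuousAt g (((1:ℝ):ℂ) * z) :=
        hg.continuousOn.continuousAt (Metric.isOpen_ball.mem_nhds (by simp [hz, hr1]))
      have h2 : ContinuousAt (fun t : ℝ => (t:ℂ) * z) 1 := by fun_prop
      exact Complex.continuous_re.continuousAt.comp (ContinuousAt.comp (f := fun t : ℝ => (t:ℂ) * z) h1 h2)
    have ht := hc.tendsto.mono_left (nhdsWithin_le_nhds (s := Set.Iio (1:ℝ)))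
    have : 1 / 2 ≤ (g (((1:ℝ):ℂ) * z)).re := by
      refine ge_of_tendsto ht ?_
      filter_upwards [Ioo_mem_nhdsLT (zero_lt_one' ℝ)] with t ht
      refine (hin _ ?_).le
      rw [norm_mul, Complex.norm_real, Real.norm_of_nonneg ht.1.le, hz]
      nlinarith [ht.2]
    simpa using this
  have hre0 : (g z0).re = 1 / 2 := le_antisymm hz0h' (hbd z0 rfl)
  have hgd : HasDerivAt g (deriv g z0) z0 :=
    (hg.differentiableAt (Metric.isOpen_ball.mem_nhds hz0b)).hasDerivAt
  -- tangential condition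
  have him : (z0 * deriv g z0).im = 0 := by
    have hd1 : HasDerivAt (fun w : ℂ => g (z0 * Complex.exp (w * Complex.I)))
        (deriv g z0 * (z0 * Complex.I)) ((0:ℝ):ℂ) := by
      have h1 : HasDerivAt (fun w : ℂ => z0 * Complex.exp (w * Complex.I)) (z0 * Complex.I) ((0:ℝ):ℂ) := by
        have := (((hasDerivAt_id (((0:ℝ):ℂ))).mul_const Complex.I).cexp).const_mul z0
        simpa using this
      have h2 : HasDerivAt g (deriv g z0) (z0 * Complex.exp ((((0:ℝ):ℂ)) * Complex.I)) := by
        simpa using hgd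
      exact HasDerivAt.comp (h₂ := g) _ h2 h1
    have hd2 := hd1.real_of_complex
    have hmin2 : IsLocalMin (fun x : ℝ => (g (z0 * Complex.exp ((x:ℂ) * Complex.I))).re) 0 := by
      refine Filter.Eventually.of_forall fun x => ?_
      have : (g (z0 * Complex.exp (((0:ℝ):ℂ) * Complex.I))).re = 1 / 2 := by simpa using hre0
      show (g (z0 * Complex.exp (((0:ℝ):ℂ) * Complex.I))).re ≤ _
      rw [this]
      exact hbd _ (by rw [norm_mul, Complex.norm_exp_ofReal_mul_I, mul_one])
    have h0 := hmin2.hasDerivAt_eq_zero hd2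
    rw [show deriv g z0 * (z0 * Complex.I) = (z0 * deriv g z0) * Complex.I by ring] at h0
    rw [Complex.mul_I_re] at h0
    linarith
  -- radial condition
  set r := ‖z0‖ with hr
  have hc0 : 0 ≤ r * b := by positivity
  have hc1 : r * b < 1 := by nlinarith
  have hball : ∀ z ∈ Metric.ball (0:ℂ) 1, ‖(r:ℂ) * z‖ < r := by
    intro z hz
    have : ‖z‖ < 1 := by simpa using hz
    rw [norm_mul, Complex.norm_real, Real.norm_of_nonneg hr0.le]
    nlinarith
  have hHd : DifferentiableOn ℂ (fun z => g ((r:ℂ) * z)) (Metric.ball 0 1) := by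
    refine DifferentiableOn.comp (g := g) hg (by fun_prop) ?_
    intro z hz
    simpa using (hball z hz).trans hr1
  have hH1 : deriv (fun z => g ((r:ℂ) * z)) 0 = ((r * b : ℝ) : ℂ) := by
    have h2 : HasDerivAt g (b:ℂ) ((r:ℂ) * 0) := by
      rw [← hgb, mul_zero]
      exact (hg.differentiableAt (Metric.ball_mem_nhds _ one_pos)).hasDerivAt
    have := (HasDerivAt.comp (h₂ := g) (0:ℂ) h2 ((hasDerivAt_id (0:ℂ)).const_mul (r:ℂ))).deriv
    simp only [mul_one] at this
    rw [Complex.ofReal_mul, mul_comm]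
    exact this
  have hrad : ∀ t ∈ Set.Ioo (0:ℝ) 1, (1 - 2 * (g ((t:ℂ) * z0)).re) * (1 + (r * b) * t) ^ 2 +
      ((1 + (r * b) * t) ^ 2 - t ^ 2 * (t + r * b) ^ 2) *
        ((g ((t:ℂ) * z0)).re ^ 2 + (g ((t:ℂ) * z0)).im ^ 2) ≤ 0 := by
    intro t ht
    have hrc : (r:ℂ) ≠ 0 := by exact_mod_cast hr0.ne'
    have hn : ‖(t:ℂ) * (z0 / r)‖ = t := by
      rw [norm_mul, norm_div, Complex.norm_real, Complex.norm_real, Real.norm_of_nonneg ht.1.le,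
        Real.norm_of_nonneg hr0.le, ← hr, div_self hr0.ne', mul_one]
    have h := half_aux (fun z => g ((r:ℂ) * z)) (r * b) hc0 hc1 hHd
      (fun z hz => hin _ (hball z hz)) (by simpa using hg0) hH1 ((t:ℂ) * (z0 / r))
      (by rw [mem_ball_zero_iff, hn]; exact ht.2)
    rw [hn] at h
    have e : (r:ℂ) * ((t:ℂ) * (z0 / r)) = t * z0 := by field_simp
    simp only [e] at h
    exact h
  have hdt : HasDerivAt (fun w : ℂ => g (w * z0)) (deriv g z0 * z0) ((1:ℝ):ℂ) := by
    have h2 : HasDerivAt g (deriv g z0) (((1:ℝ):ℂ) * z0) := by simpa using hgd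
    have := HasDerivAt.comp (h₂ := g) ((1:ℝ):ℂ) h2 ((hasDerivAt_id ((1:ℝ):ℂ)).mul_const z0)
    simp only [one_mul] at this
    exact this
  have hdre : HasDerivAt (fun t : ℝ => (g ((t:ℂ) * z0)).re) (deriv g z0 * z0).re 1 := hdt.real_of_complex
  have hdim : HasDerivAt (fun t : ℝ => (g ((t:ℂ) * z0)).im) (deriv g z0 * z0).im 1 := by
    have := (hdt.const_mul (-Complex.I)).real_of_complex
    simpa using this
  have hA : HasDerivAt (fun t : ℝ => 1 + (r * b) * t) (r * b) 1 := by
    simpa using ((hasDerivAt_id (1:ℝ)).const_mul (r * b)).const_add 1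
  have hB : HasDerivAt (fun t : ℝ => t + r * b) 1 1 := (hasDerivAt_id (1:ℝ)).add_const _
  have hI : HasDerivAt (fun t : ℝ => t) 1 1 := hasDerivAt_id (1:ℝ)
  have hF := (((hdre.const_mul 2).const_sub 1).mul (hA.pow 2)).add
    (((hA.pow 2).sub ((hI.pow 2).mul (hB.pow 2))).mul ((hdre.pow 2).add (hdim.pow 2)))
  have hF0 := left_deriv_aux _ _ hF (by
    intro t ht
    have h := hrad t ht
    simp only [Pi.add_apply, Pi.mul_apply, Pi.sub_apply, Pi.pow_apply, Complex.ofReal_one, one_mul, hre0]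
    refine h.trans (le_of_eq ?_)
    ring)
  simp only [Pi.add_apply, Pi.mul_apply, Pi.sub_apply, Pi.pow_apply, Complex.ofReal_one, one_mul, hre0] at hF0
  rw [mul_comm z0] at him
  have hXr : (deriv g z0 * z0).re * (1 + r * b) ≤ -2 * (1 / 4 + (g z0).im ^ 2) := by
    have hpos : 0 < 1 + r * b := by linarith
    have : 0 ≤ 2 * (1 + r * b) * (-((deriv g z0 * z0).re * (1 + r * b)) - 2 * (1 / 4 + (g z0).im ^ 2)) := by
      rw [him] at hF0
      norm_num at hF0 ⊢
      nlinarith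
    have := nonneg_of_mul_nonneg_right this (by linarith)
    linarith
  have hX : (deriv g z0 * z0).re * (1 + b) ≤ -2 * (1 / 4 + (g z0).im ^ 2) := by
    have hneg : (deriv g z0 * z0).re ≤ 0 := by
      by_contra h
      push Not at h
      nlinarith [sq_nonneg (g z0).im, mul_nonneg h.le hc0]
    have : r * b ≤ b := by nlinarith
    nlinarith
  have hp0 : (p:ℂ) ≠ 0 := by exact_mod_cast (by omega : p ≠ 0)
  have hs := hs2 z0 hz0b hz0ne
  have hdf : deriv f z0 = (p:ℂ) * z0 ^ (p-1) * g z0 + z0 ^ p * deriv g z0 := by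
    have he : f =ᶠ[nhds z0] fun z => z ^ p * g z := by
      filter_upwards [Metric.isOpen_ball.mem_nhds hz0b] with z hz using hfg z hz
    rw [he.deriv_eq]
    exact ((hasDerivAt_pow p z0).mul hgd).deriv
  have hsp : (s z0) ^ 2 * (p:ℂ) = p * g z0 + deriv g z0 * z0 := by
    rw [hs, hdf]
    obtain ⟨k, rfl⟩ : ∃ k, p = k + 1 := ⟨p - 1, by omega⟩
    have := pow_ne_zero k hz0ne
    simp only [Nat.add_sub_cancel]
    field_simp
    ring
  have e1 := congrArg Complex.re hsp
  have e2 := congrArg Complex.im hsp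
  rw [Complex.add_re] at e1
  rw [Complex.add_im, him] at e2
  simp only [pow_two, Complex.mul_re, Complex.mul_im, Complex.natCast_re, Complex.natCast_im, hre0] at e1 e2
  have hpr : (1:ℝ) ≤ p := by exact_mod_cast hp
  have hsx := hre z0 hz0b
  have hx : (1 + b) * p / 8 < (s z0).re ^ 2 :=
    (Real.sqrt_lt' (lt_of_le_of_lt (Real.sqrt_nonneg _) hsx)).mp hsx
  refine final_aux (s z0).re (s z0).im _ (g z0).im b p hpr hb0 hx hX ?_ ?_
  · simp only [Complex.mul_re]
    linarith
  · have : (p:ℝ) * (2 * (s z0).re * (s z0).im) = p * (g z0).im := by linarith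
    exact mul_left_cancel₀ (by linarith) this
end

section
/- Let p ∈ ℕ (p ≥ 1), 0 < β < 1, and set α = p − β/(1−β) if 0 < β ≤ 1/2, and α = p − (1−β)/β if 1/2 ≤ β < 1. Then for every ρ ∈ ℝ and every σ ∈ ℝ with σ ≤ −(1+ρ²)/2, one has Re(2(1−β)σ/((1−β)iρ + β) + p) ≤ α; equivalently, 2β(1−β)σ/((1−β)²ρ² + β²) + p ≤ α. -/
open Complex in
/-- Admissibility condition in Theorem 2.2: for `σ ≤ -(1+ρ²)/2`,
`Re(2(1-β)σ/((1-β)iρ + β) + p) ≤ α`, equivalently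
`2β(1-β)σ/((1-β)²ρ² + β²) + p ≤ α`. -/
theorem stmt_12 (p : ℕ) (hp : 1 ≤ p) (β α : ℝ) (hβ0 : 0 < β) (hβ1 : β < 1)
    (hα : α = if β ≤ 1 / 2 then (p : ℝ) - β / (1 - β) else (p : ℝ) - (1 - β) / β)
    (ρ σ : ℝ) (hσ : σ ≤ -(1 + ρ ^ 2) / 2) :
    ((2 * (1 - (β : ℂ)) * (σ : ℂ) / ((1 - (β : ℂ)) * Complex.I * (ρ : ℂ) + (β : ℂ))
        + (p : ℂ)).re ≤ α) ∧
    (2 * β * (1 - β) * σ / ((1 - β) ^ 2 * ρ ^ 2 + β ^ 2) + (p : ℝ) ≤ α) := by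
  have h1 : 0 < 1 - β := by linarith
  have hD : 0 < (1 - β) ^ 2 * ρ ^ 2 + β ^ 2 := by positivity
  have key : 2 * β * (1 - β) * σ / ((1 - β) ^ 2 * ρ ^ 2 + β ^ 2) + (p : ℝ) ≤ α := by
    have hbb : 0 < β * (1 - β) := by positivity
    have hs : 2 * β * (1 - β) * σ ≤ -(β * (1 - β) * (1 + ρ ^ 2)) := by nlinarith
    rw [hα]
    split_ifs with h
    · have : 2 * β * (1 - β) * σ / ((1 - β) ^ 2 * ρ ^ 2 + β ^ 2) ≤ -(β / (1 - β)) := by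
        rw [div_le_iff₀ hD]
        refine hs.trans ?_
        have e : -(β / (1 - β)) * ((1 - β) ^ 2 * ρ ^ 2 + β ^ 2) + β * (1 - β) * (1 + ρ ^ 2)
            = β * (1 - 2 * β) / (1 - β) := by
          field_simp
          ring
        have : 0 ≤ β * (1 - 2 * β) / (1 - β) :=
          div_nonneg (mul_nonneg hβ0.le (by linarith)) h1.le
        linarith
      linarith
    · have : 2 * β * (1 - β) * σ / ((1 - β) ^ 2 * ρ ^ 2 + β ^ 2) ≤ -((1 - β) / β) := by
        rw [div_le_iff₀ hD]
        refine hs.trans ?_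
        have e : -((1 - β) / β) * ((1 - β) ^ 2 * ρ ^ 2 + β ^ 2) + β * (1 - β) * (1 + ρ ^ 2)
            = (1 - β) * (ρ ^ 2 * (2 * β - 1)) / β := by
          field_simp
          ring
        have : 0 ≤ (1 - β) * (ρ ^ 2 * (2 * β - 1)) / β :=
          div_nonneg (mul_nonneg h1.le (mul_nonneg (sq_nonneg _) (by linarith))) hβ0.le
        linarith
      linarith
  refine ⟨?_, key⟩
  convert key using 1
  simp [Complex.div_re, Complex.normSq_apply]
  congr 1 <;> ring
end

section
/- Let p ∈ ℕ (p ≥ 1) and let γ be a real number with (p²+1)/(p+1)² < γ < 1. If ξ, η ∈ ℝ satisfy ξ ≤ γ − ((1−γ)² + η²)/(2p(1−γ)), then ξ + √(ξ² + η²) ≤ ((2p+1)γ − 1)/p. -/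
/-- Key estimate in Theorem 2.4: for `(p²+1)/(p+1)² < γ < 1` and
`ξ ≤ γ - ((1-γ)² + η²)/(2p(1-γ))`, one has `ξ + √(ξ² + η²) ≤ ((2p+1)γ - 1)/p`. -/
theorem stmt_13 (p : ℕ) (hp : 1 ≤ p) (γ : ℝ)
    (hγ1 : ((p : ℝ) ^ 2 + 1) / ((p : ℝ) + 1) ^ 2 < γ) (hγ2 : γ < 1)
    (ξ η : ℝ) (hξ : ξ ≤ γ - ((1 - γ) ^ 2 + η ^ 2) / (2 * (p : ℝ) * (1 - γ))) :
    ξ + Real.sqrt (ξ ^ 2 + η ^ 2) ≤ ((2 * (p : ℝ) + 1) * γ - 1) / (p : ℝ) := by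
  have hP : (0 : ℝ) < (p : ℝ) := by exact_mod_cast hp
  generalize (p : ℝ) = P at *
  obtain ⟨d, rfl⟩ : ∃ d, γ = 1 - d := ⟨1 - γ, by ring⟩
  have hd : 0 < d := by linarith
  rw [div_lt_iff₀ (by positivity)] at hγ1
  obtain ⟨K, hK⟩ : ∃ K, K = ((2 * P + 1) * (1 - d) - 1) / P := ⟨_, rfl⟩
  have hKP : K * P = (2 * P + 1) * (1 - d) - 1 := by
    rw [hK]; field_simp
  rw [← hK]
  have hKd : P * d ≤ K := by
    have : P * d * P ≤ K * P := by rw [hKP]; nlinarith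
    exact le_of_mul_le_mul_right this hP
  have hPd : 0 < P * d := by positivity
  have hK0 : 0 < K := by linarith
  obtain ⟨t, ht⟩ : ∃ t, t = η ^ 2 / (P * d) := ⟨_, rfl⟩
  have ht0 : 0 ≤ t := by rw [ht]; positivity
  have htη : t * (P * d) = η ^ 2 := by rw [ht]; field_simp
  have h2 : 2 * ξ ≤ K - t := by
    have e : 2 * ((1 - d) - ((1 - (1 - d)) ^ 2 + η ^ 2) / (2 * P * (1 - (1 - d)))) = K - t := by
      rw [hK, ht, show (1 - (1 - d)) = d by ring]
      field_simp
      ring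
    linarith
  have h3 : Real.sqrt (ξ ^ 2 + η ^ 2) ≤ K - ξ := by
    apply Real.sqrt_le_iff.mpr
    constructor
    · linarith
    · have a := mul_le_mul_of_nonneg_left h2 hK0.le
      have b := mul_le_mul_of_nonneg_left hKd ht0
      nlinarith
  linarith
end

section
/- Let p ∈ ℕ (p ≥ 1) and let γ ∈ (0,1) and b ≥ 0 satisfy 0 ≤ b ≤ 2(1−γ) and p²(2(1−γ)+b)² + 16(1−γ)² − 8pγ(2(1−γ)+b) < 0. If ξ, η ∈ ℝ satisfy ξ ≤ ((4+(2+b)p)γ − 2(1+p)γ² − 2(1+η²))/(p(2(1−γ)+b)), then ξ + √(ξ² + η²) ≤ 2((4+(2+b)p)γ − 2(1+p)γ² − 2)/(p(2(1−γ)+b)). (In particular, under the stated hypotheses the quantity (4+(2+b)p)γ − 2(1+p)γ² − 2 is positive.) -/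
/-- Key estimate in Theorem 3.7: under the stated hypotheses on `p`, `γ`, `b`, if
`ξ ≤ ((4+(2+b)p)γ - 2(1+p)γ² - 2(1+η²))/(p(2(1-γ)+b))`, then
`ξ + √(ξ² + η²) ≤ 2((4+(2+b)p)γ - 2(1+p)γ² - 2)/(p(2(1-γ)+b))`; moreover
`(4+(2+b)p)γ - 2(1+p)γ² - 2 > 0`. -/
theorem stmt_16 (p : ℕ) (hp : 1 ≤ p) (γ b : ℝ) (hγ0 : 0 < γ) (hγ1 : γ < 1)
    (hb0 : 0 ≤ b) (hb1 : b ≤ 2 * (1 - γ))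
    (hcond : (p : ℝ) ^ 2 * (2 * (1 - γ) + b) ^ 2 + 16 * (1 - γ) ^ 2
      - 8 * (p : ℝ) * γ * (2 * (1 - γ) + b) < 0)
    (ξ η : ℝ)
    (hξ : ξ ≤ ((4 + (2 + b) * (p : ℝ)) * γ - 2 * (1 + (p : ℝ)) * γ ^ 2 - 2 * (1 + η ^ 2)) /
      ((p : ℝ) * (2 * (1 - γ) + b))) :
    ξ + Real.sqrt (ξ ^ 2 + η ^ 2) ≤
      2 * ((4 + (2 + b) * (p : ℝ)) * γ - 2 * (1 + (p : ℝ)) * γ ^ 2 - 2) /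
        ((p : ℝ) * (2 * (1 - γ) + b)) ∧
    0 < (4 + (2 + b) * (p : ℝ)) * γ - 2 * (1 + (p : ℝ)) * γ ^ 2 - 2 := by
  have hp' : (1 : ℝ) ≤ p := by exact_mod_cast hp
  obtain ⟨S, hS⟩ : ∃ S, S = (p : ℝ) * (2 * (1 - γ) + b) := ⟨_, rfl⟩
  obtain ⟨A, hA⟩ : ∃ A, A = (4 + (2 + b) * (p : ℝ)) * γ - 2 * (1 + (p : ℝ)) * γ ^ 2 - 2 :=
    ⟨_, rfl⟩
  have hSpos : 0 < S := by
    rw [hS]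
    apply mul_pos <;> linarith
  have hAS : A = γ * S - 2 * (1 - γ) ^ 2 := by rw [hA, hS]; ring
  have h8 : S ^ 2 < 8 * A := by
    rw [hAS, hS]
    nlinarith [hcond]
  have hApos : 0 < A := by nlinarith [sq_nonneg S]
  have e : (4 + (2 + b) * (p : ℝ)) * γ - 2 * (1 + (p : ℝ)) * γ ^ 2 - 2 * (1 + η ^ 2)
      = A - 2 * η ^ 2 := by rw [hA]; ring
  rw [e, ← hS, le_div_iff₀ hSpos] at hξ
  rw [← hA, ← hS]
  refine ⟨?_, hApos⟩
  obtain ⟨c, hc⟩ : ∃ c, c = 2 * A / S := ⟨_, rfl⟩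
  have hcS : c * S = 2 * A := by rw [hc]; field_simp
  have hcpos : 0 < c := by rw [hc]; positivity
  rw [← hc]
  have h1 : ξ ≤ c := by
    refine le_of_mul_le_mul_right ?_ hSpos
    nlinarith [sq_nonneg η]
  have h4 : S ≤ 4 * c := by
    refine le_of_mul_le_mul_right ?_ hSpos
    nlinarith
  have h3 : η ^ 2 ≤ c * (c - 2 * ξ) := by
    refine le_of_mul_le_mul_right ?_ hSpos
    have h5 : 4 * η ^ 2 ≤ (c - 2 * ξ) * S := by nlinarith
    have h6 := mul_le_mul_of_nonneg_left h5 hcpos.le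
    have h7 := mul_le_mul_of_nonneg_right h4 (sq_nonneg η)
    nlinarith
  have h2 : Real.sqrt (ξ ^ 2 + η ^ 2) ≤ c - ξ := by
    apply Real.sqrt_le_iff.mpr
    constructor
    · linarith
    · nlinarith
  linarith
end
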